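/- Let $p$ be an odd prime or $p=2$, and let $G$ be a finite abelian $p$-group. Then $\lim_{n\to\infty} \mathrm{Prob}_{X \in \mathrm{Mat}_n(\mathbb{Z}_p)}\big(\mathrm{cok}(X) = 0 \text{ and } \mathrm{cok}(X - I_n) \simeq G\big) = \left(\prod_{i=1}^{\infty}(1-p^{-i})\right) \cdot \frac{1}{|\mathrm{Aut}(G)|}\prod_{i=1}^{\infty}(1-p^{-i})$; that is, the events $\mathrm{cok}(X)=0$ and $\mathrm{cok}(X - I_n) \simeq G$ become independent as $n \to \infty$, each with its Cohen–Lenstra probability. -/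

import Mathlib

open MeasureTheory

noncomputable instance (p : ℕ) [Fact p.Prime] : MeasurableSpace ℤ_[p] := borel _

section analysis
open Filter Topology

noncomputable def cA (q : ℝ) (k : ℕ) : ℝ := (-1)^k / ∏ j ∈ Finset.range k, (q^(j+1) - 1)

lemma cA_succ (q : ℝ) (hq : 2 ≤ q) (k : ℕ) : cA q (k+1) * (q^(k+1) - 1) = - cA q k := by
  have h : q^(k+1) - 1 ≠ 0 := by
    have := one_lt_pow₀ (by linarith : 1 < q) (Nat.succ_ne_zero k)
    simp only [Nat.succ_eq_add_one] at this
    linarith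
  unfold cA
  rw [Finset.prod_range_succ, div_mul_eq_mul_div, mul_div_mul_right _ _ h, pow_succ]
  ring

lemma cA_summable (q : ℝ) (hq : 2 ≤ q) : Summable (fun k => |cA q k|) := by
  have hlim : Tendsto (fun n : ℕ => q^(n+1) - 1) atTop atTop :=
    tendsto_atTop_add_const_right _ _ ((tendsto_pow_atTop_atTop_of_one_lt (by linarith)).comp (tendsto_add_atTop_nat 1))
  have hpos : ∀ k : ℕ, 0 < q^(k+1) - 1 := fun k => by
    have := one_lt_pow₀ (by linarith : 1 < q) (Nat.succ_ne_zero k)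
    simp only [Nat.succ_eq_add_one] at this
    linarith
  have hne : ∀ k, cA q k ≠ 0 := fun k => by
    unfold cA
    exact div_ne_zero (by simp) (Finset.prod_ne_zero_iff.2 fun j _ => (hpos j).ne')
  refine (summable_of_ratio_test_tendsto_lt_one (l := 0) (f := cA q) one_pos (Eventually.of_forall hne) ?_).abs
  have : (fun n => ‖cA q (n+1)‖ / ‖cA q n‖) = fun n : ℕ => (q^(n+1) - 1)⁻¹ := by
    ext n
    have := cA_succ q hq n
    have h2 : cA q n = - (cA q (n+1) * (q^(n+1) - 1)) := by linarith
    have h3 := hne (n+1)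
    rw [h2, norm_neg, norm_mul, Real.norm_of_nonneg (hpos n).le, ← div_div, div_self (by simpa using h3), one_div]
  rw [this]
  exact hlim.inv_tendsto_atTop

lemma cA_tele (q : ℝ) (hq : 2 ≤ q) (x : ℝ) (K : ℕ) :
    ∑ k ∈ Finset.range (K+1), cA q k * ∏ i ∈ Finset.range k, (x - q^i) =
      ∏ j ∈ Finset.range K, ((q^(j+1) - x) / (q^(j+1) - 1)) := by
  have hpos : ∀ k : ℕ, 0 < q^(k+1) - 1 := fun k => by
    have := one_lt_pow₀ (by linarith : 1 < q) (Nat.succ_ne_zero k)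
    simp only [Nat.succ_eq_add_one] at this
    linarith
  induction K with
  | zero => simp [cA]
  | succ K ih =>
    rw [Finset.sum_range_succ, ih, Finset.prod_range_succ' (fun i => x - q^i),
      Finset.prod_range_succ (fun j => (q^(j+1) - x) / (q^(j+1) - 1)), Finset.prod_div_distrib]
    unfold cA
    rw [Finset.prod_range_succ (fun j => q^(j+1) - 1)]
    have h1 : ∏ k ∈ Finset.range K, (x - q^(k+1)) = (-1)^K * ∏ k ∈ Finset.range K, (q^(k+1) - x) := by
      rw [← Finset.card_range K, ← Finset.prod_const, Finset.card_range, ← Finset.prod_mul_distrib]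
      exact Finset.prod_congr rfl fun _ _ => by ring
    have h2 : ((-1 : ℝ)^K) * (-1)^K = 1 := by rw [← mul_pow]; simp
    have h3 : ∏ j ∈ Finset.range K, (q^(j+1) - 1) ≠ 0 := Finset.prod_ne_zero_iff.2 fun j _ => (hpos j).ne'
    have h4 := (hpos K).ne'
    rw [h1, pow_succ]
    field_simp
    linear_combination (-(x - 1)) * (∏ k ∈ Finset.range K, (q^(k+1) - x)) * h2

lemma cA_delta (q : ℝ) (hq : 2 ≤ q) (n d : ℕ) (hd : d ≤ n) :
    ∑ k ∈ Finset.range (n+1), cA q k * ∏ i ∈ Finset.range k, (q^d - q^i) = if d = 0 then 1 else 0 := by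
  rw [cA_tele q hq]
  split_ifs with h
  · subst h
    refine Finset.prod_eq_one fun j _ => ?_
    have := one_lt_pow₀ (by linarith : 1 < q) (Nat.succ_ne_zero j)
    simp only [Nat.succ_eq_add_one] at this
    rw [pow_zero, div_self (by linarith)]
  · refine Finset.prod_eq_zero (i := d - 1) (by simp; omega) ?_
    rw [Nat.sub_add_cancel (by omega)]; simp

lemma euler_multipliable (q : ℝ) (hq : 2 ≤ q) : Multipliable (fun i : ℕ => (1 - q⁻¹^(i+1))) := by
  have : Summable (fun i : ℕ => - q⁻¹^(i+1)) := by
    refine Summable.neg ?_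
    refine (summable_nat_add_iff 1).2 (summable_geometric_of_lt_one (by positivity) ?_)
    exact inv_lt_one_of_one_lt₀ (by linarith)
  simpa [sub_eq_add_neg] using Real.multipliable_one_add_of_summable this

lemma euler_tendsto (q : ℝ) (hq : 2 ≤ q) : Tendsto (fun n => ∏ i ∈ Finset.range n, (1 - q⁻¹^(i+1))) atTop
    (𝓝 (∏' i : ℕ, (1 - q⁻¹^(i+1)))) := (euler_multipliable q hq).hasProd.tendsto_prod_nat

lemma cA_tsum (q : ℝ) (hq : 2 ≤ q) : ∑' k, cA q k = ∏' i : ℕ, (1 - q⁻¹^(i+1)) := by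
  have hs := cA_summable q hq
  have hq0 : q ≠ 0 := by linarith
  have hqi : q⁻¹ < 1 := inv_lt_one_of_one_lt₀ (by linarith)
  have hqp : 0 < q⁻¹ := by positivity
  have hsx : ∀ x : ℝ, |x| ≤ 1 → Summable (fun k => cA q k * x^k) := fun x hx => by
    refine Summable.of_norm_bounded hs fun k => ?_
    rw [norm_mul, norm_pow, Real.norm_eq_abs, Real.norm_eq_abs]
    exact mul_le_of_le_one_right (abs_nonneg _) (pow_le_one₀ (abs_nonneg _) hx)
  have hfe : ∀ x : ℝ, |x| ≤ 1 → ∑' k, cA q k * x^k = (1 - q⁻¹ * x) * ∑' k, cA q k * (q⁻¹ * x)^k := by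
    intro x hx
    have hy : |q⁻¹ * x| ≤ 1 := by
      rw [abs_mul, abs_of_pos hqp]; nlinarith [abs_nonneg x]
    have h1 := hsx x hx
    have h2 := hsx _ hy
    have h3 : ∑' k, (cA q k * x^k - cA q k * (q⁻¹ * x)^k) = - (q⁻¹ * x) * ∑' k, cA q k * (q⁻¹ * x)^k := by
      rw [(h1.sub h2).tsum_eq_zero_add, ← tsum_mul_left]
      simp only [pow_zero, sub_self, zero_add]
      refine tsum_congr fun k => ?_
      have := cA_succ q hq k
      have e : x = q * (q⁻¹ * x) := by field_simp
      generalize q⁻¹ * x = y at *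
      subst e
      rw [mul_pow]
      linear_combination y^(k+1) * this
    rw [h1.tsum_sub h2] at h3
    linear_combination h3
  have hN : ∀ N : ℕ, ∑' k, cA q k = (∏ i ∈ Finset.range N, (1 - q⁻¹^(i+1))) * ∑' k, cA q k * (q⁻¹^N)^k := by
    intro N
    induction N with
    | zero => simp
    | succ N ih =>
      rw [ih, hfe, Finset.prod_range_succ, pow_succ']
      · ring
      · rw [abs_of_nonneg (by positivity)]; exact pow_le_one₀ hqp.le hqi.le
  have hlim : Tendsto (fun N : ℕ => ∑' k, cA q k * (q⁻¹^N)^k) atTop (𝓝 (∑' k, cA q k * 0^k)) := by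
    refine tendsto_tsum_of_dominated_convergence hs (fun k => ?_) (Eventually.of_forall fun N k => ?_)
    · exact ((tendsto_pow_atTop_nhds_zero_of_lt_one hqp.le hqi).pow k).const_mul _
    · rw [norm_mul, norm_pow, Real.norm_eq_abs, Real.norm_eq_abs]
      refine mul_le_of_le_one_right (abs_nonneg _) (pow_le_one₀ (abs_nonneg _) ?_)
      rw [abs_of_nonneg (by positivity)]; exact pow_le_one₀ hqp.le hqi.le
  have h0 : ∑' k, cA q k * (0:ℝ)^k = 1 := by
    rw [tsum_eq_single 0 (fun k hk => by simp [hk])]; simp [cA]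
  rw [h0] at hlim
  have := (euler_tendsto q hq).mul hlim
  rw [mul_one] at this
  refine tendsto_nhds_unique ?_ this
  simp_rw [← hN]
  exact tendsto_const_nhds

section counting
open Classical Module

lemma card_LI {F W : Type*} [Field F] [Fintype F] [AddCommGroup W] [Module F W] [Finite W] (k : ℕ) :
    (Nat.card {s : Fin k → W // LinearIndependent F s} : ℝ) =
      ∏ i ∈ Finset.range k, ((Fintype.card F : ℝ)^(finrank F W) - (Fintype.card F : ℝ)^i) := by
  by_cases hk : k ≤ finrank F W
  · have := Fintype.ofFinite W
    rw [card_linearIndependent hk, Finset.prod_range]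
    push_cast
    refine Finset.prod_congr rfl fun i _ => ?_
    rw [Nat.cast_sub (Nat.pow_le_pow_right Fintype.card_pos (by omega))]
    simp
  · push Not at hk
    rw [Finset.prod_eq_zero (i := finrank F W) (by simpa using hk) (by simp)]
    have : IsEmpty {s : Fin k → W // LinearIndependent F s} := ⟨fun s => by
      have := s.2.fintype_card_le_finrank
      simp at this; omega⟩
    simp

variable {F : Type*} [Field F] [Fintype F]

lemma ker_count (n : ℕ) (hF : (2:ℝ) ≤ Fintype.card F) (M : Matrix (Fin n) (Fin n) F) :
    ∑ k ∈ Finset.range (n+1), cA (Fintype.card F) k *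
      (Nat.card {w : Fin k → (Fin n → F) // LinearIndependent F w ∧ ∀ i, M.mulVec (w i) = 0} : ℝ) =
      if M.det ≠ 0 then 1 else 0 := by
  have h : ∀ k, (Nat.card {w : Fin k → (Fin n → F) // LinearIndependent F w ∧ ∀ i, M.mulVec (w i) = 0} : ℝ)
      = ∏ i ∈ Finset.range k, ((Fintype.card F : ℝ)^(finrank F (LinearMap.ker M.mulVecLin)) - (Fintype.card F : ℝ)^i) := by
    intro k
    rw [← card_LI]
    congr 1
    refine Nat.card_congr ⟨fun w => ⟨fun i => ⟨w.1 i, by simpa using w.2.2 i⟩, ?_⟩, fun s => ⟨fun i => s.1 i, ?_, ?_⟩, ?_, ?_⟩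
    · exact LinearIndependent.of_comp (LinearMap.ker M.mulVecLin).subtype w.2.1
    · exact s.2.map' (LinearMap.ker M.mulVecLin).subtype (by simp)
    · intro i; exact LinearMap.mem_ker.1 (s.1 i).2
    · intro w; rfl
    · intro w; rfl
  simp_rw [h]
  rw [cA_delta _ hF _ _ ((Submodule.finrank_le _).trans (by simp))]
  have : finrank F (LinearMap.ker M.mulVecLin) = 0 ↔ M.det ≠ 0 := by
    rw [Submodule.finrank_eq_zero, LinearMap.ker_eq_bot, Matrix.coe_mulVecLin, Matrix.mulVec_injective_iff_isUnit,
      Matrix.isUnit_iff_isUnit_det, isUnit_iff_ne_zero]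
  simp only [this]

lemma exists_GL (n k : ℕ) (w v : Fin k → (Fin n → F)) (hw : LinearIndependent F w) (hv : LinearIndependent F v) :
    ∃ g : GL (Fin n) F, ∀ i, g.1.mulVec (w i) = v i := by
  let b := Basis.sumExtend hw
  let c := Basis.sumExtend hv
  have hb : ∀ i, b (Sum.inl i) = w i := fun i => by simp [b, Basis.sumExtend]; rfl
  have hc : ∀ i, c (Sum.inl i) = v i := fun i => by simp [c, Basis.sumExtend]; rfl
  have : Nat.card (Basis.sumExtendIndex hw) = Nat.card (Basis.sumExtendIndex hv) := by
    have h1 := finrank_eq_nat_card_basis b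
    have h2 := finrank_eq_nat_card_basis c
    rw [Nat.card_sum] at h1 h2
    omega
  let e : Basis.sumExtendIndex hw ≃ Basis.sumExtendIndex hv := (Finite.card_eq.1 this).some
  let f := b.equiv c (Equiv.sumCongr (Equiv.refl _) e)
  refine ⟨Matrix.GeneralLinearGroup.toLin.symm ((LinearMap.GeneralLinearGroup.generalLinearEquiv F _).symm f), fun i => ?_⟩
  have : f (w i) = v i := by rw [← hb, ← hc]; simp [f]
  rw [← this]
  change (LinearMap.toMatrix' f.toLinearMap).mulVec (w i) = _
  rw [LinearMap.toMatrix'_mulVec]; rfl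

lemma fiber_count (n k : ℕ) (w v : Fin k → (Fin n → F)) (hw : LinearIndependent F w) (hv : LinearIndependent F v) :
    Nat.card {s : Fin k → (Fin n → F) // LinearIndependent F s} *
      Nat.card {U : GL (Fin n) F // ∀ i, U.1.mulVec (w i) = v i} = Nat.card (GL (Fin n) F) := by
  have key : ∀ s : {s : Fin k → (Fin n → F) // LinearIndependent F s},
      Nat.card {U : GL (Fin n) F // ∀ i, U.1.mulVec (w i) = s.1 i} = Nat.card {U : GL (Fin n) F // ∀ i, U.1.mulVec (w i) = v i} := by
    intro s
    obtain ⟨g, hg⟩ := exists_GL n k s.1 v s.2 hv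
    refine Nat.card_congr ((Equiv.mulLeft g).subtypeEquiv fun U => ?_)
    refine forall_congr' fun i => ?_
    simp only [Equiv.coe_mulLeft, Units.val_mul, ← Matrix.mulVec_mulVec]
    rw [← hg i]
    exact ((Matrix.mulVec_injective_iff_isUnit.2 g.isUnit).eq_iff).symm
  have e : (Σ s : {s : Fin k → (Fin n → F) // LinearIndependent F s}, {U : GL (Fin n) F // ∀ i, U.1.mulVec (w i) = s.1 i}) ≃ GL (Fin n) F :=
    { toFun := fun x => x.2.1
      invFun := fun U => ⟨⟨fun i => U.1.mulVec (w i), by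
        exact hw.map' U.1.mulVecLin (LinearMap.ker_eq_bot.2 (Matrix.mulVec_injective_iff_isUnit.2 U.isUnit))⟩, ⟨U, fun i => rfl⟩⟩
      left_inv := by
        rintro ⟨⟨s, hs⟩, ⟨U, hU⟩⟩
        obtain rfl : (fun i => U.1.mulVec (w i)) = s := funext hU
        rfl
      right_inv := fun U => rfl }
  rw [← Nat.card_congr e, Nat.card_sigma, Finset.sum_congr rfl (fun s _ => key s)]
  simp [Nat.card_eq_fintype_card]

lemma double_count (n k : ℕ) (B : Matrix (Fin n) (Fin n) F) :
    ∑ U : GL (Fin n) F, (Nat.card {w : Fin k → (Fin n → F) // LinearIndependent F w ∧ ∀ i, (U.1 + B).mulVec (w i) = 0} : ℝ)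
     = Nat.card (GL (Fin n) F) * ((Nat.card {w : Fin k → (Fin n → F) // LinearIndependent F (fun i => B.mulVec (w i))} : ℝ) /
        Nat.card {s : Fin k → (Fin n → F) // LinearIndependent F s}) := by
  have hLI : ∀ w : Fin k → (Fin n → F), LinearIndependent F (fun i => B.mulVec (w i)) → LinearIndependent F w :=
    fun w hw => LinearIndependent.of_comp B.mulVecLin hw
  have e : (Σ U : GL (Fin n) F, {w : Fin k → (Fin n → F) // LinearIndependent F w ∧ ∀ i, (U.1 + B).mulVec (w i) = 0}) ≃
     (Σ w : {w : Fin k → (Fin n → F) // LinearIndependent F (fun i => B.mulVec (w i))}, {U : GL (Fin n) F // ∀ i, U.1.mulVec (w.1 i) = - B.mulVec (w.1 i)}) :=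
    { toFun := fun x => ⟨⟨x.2.1, by
          have h := x.2.2.1.map' x.1.1.mulVecLin (LinearMap.ker_eq_bot.2 (Matrix.mulVec_injective_iff_isUnit.2 x.1.isUnit))
          have h2 : (fun i => B.mulVec (x.2.1 i)) = fun i => (-1 : Fˣ) • x.1.1.mulVec (x.2.1 i) := by
            ext1 i
            have := x.2.2.2 i
            rw [Matrix.add_mulVec] at this
            rw [eq_neg_of_add_eq_zero_right this]
            simp [Units.smul_def]
          rw [h2]
          exact h.units_smul (fun _ => (-1 : Fˣ))⟩, ⟨x.1, fun i => by
            have := x.2.2.2 i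
            rw [Matrix.add_mulVec] at this
            exact eq_neg_of_add_eq_zero_left this⟩⟩
      invFun := fun x => ⟨x.2.1, ⟨x.1.1, hLI _ x.1.2, fun i => by
        rw [Matrix.add_mulVec, x.2.2 i]; simp⟩⟩
      left_inv := fun x => rfl
      right_inv := fun x => rfl }
  have h1 := Nat.card_congr e
  rw [Nat.card_sigma, Nat.card_sigma] at h1
  have h1' := congrArg (Nat.cast : ℕ → ℝ) h1
  push_cast at h1'
  rw [h1']
  have key : ∀ w : {w : Fin k → (Fin n → F) // LinearIndependent F (fun i => B.mulVec (w i))},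
     (Nat.card {U : GL (Fin n) F // ∀ i, U.1.mulVec (w.1 i) = - B.mulVec (w.1 i)} : ℝ) =
       Nat.card (GL (Fin n) F) / Nat.card {s : Fin k → (Fin n → F) // LinearIndependent F s} := by
    intro w
    have h2 : LinearIndependent F (fun i => - B.mulVec (w.1 i)) := by
      have := w.2.units_smul (fun _ => (-1 : Fˣ))
      convert this using 1
      ext1 i; simp [Units.smul_def]
    have := fiber_count n k w.1 _ (hLI _ w.2) h2
    have hne : Nat.card {s : Fin k → (Fin n → F) // LinearIndependent F s} ≠ 0 := by
      intro h0
      have : Nonempty {s : Fin k → (Fin n → F) // LinearIndependent F s} := ⟨⟨_, w.2⟩⟩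
      exact Nat.card_pos.ne' h0
    rw [← this]
    push_cast
    field_simp
  rw [Finset.sum_congr rfl fun w _ => key w]
  simp [Nat.card_eq_fintype_card]
  ring

lemma pair_count (n : ℕ) (hF : (2:ℝ) ≤ Fintype.card F) (B : Matrix (Fin n) (Fin n) F) :
    (Nat.card {U : GL (Fin n) F // (U.1 + B).det ≠ 0} : ℝ) = Nat.card (GL (Fin n) F) *
      ∑ k ∈ Finset.range (n+1), cA (Fintype.card F) k *
       ((Nat.card {w : Fin k → (Fin n → F) // LinearIndependent F (fun i => B.mulVec (w i))} : ℝ) /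
        Nat.card {s : Fin k → (Fin n → F) // LinearIndependent F s}) := by
  have h1 : (Nat.card {U : GL (Fin n) F // (U.1 + B).det ≠ 0} : ℝ) = ∑ U : GL (Fin n) F, if (U.1 + B).det ≠ 0 then 1 else 0 := by
    rw [Nat.card_eq_fintype_card, Fintype.card_subtype, Finset.sum_boole]
  rw [h1, Finset.sum_congr rfl fun U _ => (ker_count n hF (U.1 + B)).symm, Finset.sum_comm, Finset.mul_sum]
  refine Finset.sum_congr rfl fun k _ => ?_
  rw [← Finset.mul_sum, double_count]
  ring

lemma card_ker_range {F V W : Type*} [Field F] [AddCommGroup V] [AddCommGroup W] [Module F V] [Module F W] (f : V →ₗ[F] W) :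
    Nat.card (LinearMap.ker f) * Nat.card (LinearMap.range f) = Nat.card V := by
  rw [Submodule.card_eq_card_quotient_mul_card (LinearMap.ker f), Nat.card_congr f.quotKerEquivRange.toEquiv, mul_comm]

lemma ratio_bound (n k : ℕ) (B : Matrix (Fin n) (Fin n) F) (g : ℕ)
    (hg : Nat.card (LinearMap.ker B.mulVecLin) ≤ g) (hk : k ≤ n) :
    ((Nat.card {w : Fin k → (Fin n → F) // LinearIndependent F (fun i => B.mulVec (w i))} : ℝ) /
        Nat.card {s : Fin k → (Fin n → F) // LinearIndependent F s}) ≤ 1 ∧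
    1 - g * (Fintype.card F : ℝ)^k / (Fintype.card F : ℝ)^n ≤
    ((Nat.card {w : Fin k → (Fin n → F) // LinearIndependent F (fun i => B.mulVec (w i))} : ℝ) /
        Nat.card {s : Fin k → (Fin n → F) // LinearIndependent F s}) := by
  have hLI : ∀ w : Fin k → (Fin n → F), LinearIndependent F (fun i => B.mulVec (w i)) → LinearIndependent F w :=
    fun w hw => LinearIndependent.of_comp B.mulVecLin hw
  have hcI : Nat.card {w : Fin k → (Fin n → F) // LinearIndependent F (fun i => B.mulVec (w i))} ≤
      Nat.card {s : Fin k → (Fin n → F) // LinearIndependent F s} :=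
    Nat.card_le_card_of_injective (fun w => ⟨w.1, hLI _ w.2⟩) (fun a b h => by
      simpa [Subtype.ext_iff] using h)
  refine ⟨div_le_one_of_le₀ (by exact_mod_cast hcI) (by positivity), ?_⟩
  set q : ℝ := ((Fintype.card F : ℕ) : ℝ) with hq
  have hq0 : 0 < q := by rw [hq]; exact_mod_cast Fintype.card_pos
  have hV : (Nat.card (Fin k → Fin n → F) : ℝ) = (q^n)^k := by
    simp [hq]
  have hIle : (Nat.card {s : Fin k → (Fin n → F) // LinearIndependent F s} : ℝ) ≤ (q^n)^k := by
    rw [← hV]; exact_mod_cast Nat.card_le_card_of_injective _ Subtype.val_injective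
  have hIpos : 0 < (Nat.card {s : Fin k → (Fin n → F) // LinearIndependent F s} : ℝ) := by
    have : Nonempty {s : Fin k → (Fin n → F) // LinearIndependent F s} :=
      ⟨⟨fun i => Pi.basisFun F (Fin n) (Fin.castLE hk i), (Pi.basisFun F (Fin n)).linearIndependent.comp _ (Fin.castLE_injective hk)⟩⟩
    exact_mod_cast Nat.card_pos
  have hbad : (Nat.card {w : Fin k → (Fin n → F) // ¬ LinearIndependent F (fun i => B.mulVec (w i))} : ℝ) ≤
      q^k * (g * (q^n)^k / q^n) := by
    let L : (Fin k → F) → ((Fin k → (Fin n → F)) →ₗ[F] (Fin n → F)) := fun a =>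
      B.mulVecLin ∘ₗ (∑ i, a i • LinearMap.proj i)
    have hsub : Nat.card {w : Fin k → (Fin n → F) // ¬ LinearIndependent F (fun i => B.mulVec (w i))} ≤
        Nat.card (Σ a : {a : Fin k → F // a ≠ 0}, LinearMap.ker (L a.1)) := by
      have : ∀ w : {w : Fin k → (Fin n → F) // ¬ LinearIndependent F (fun i => B.mulVec (w i))},
          ∃ a : Fin k → F, a ≠ 0 ∧ L a w.1 = 0 := by
        intro w
        obtain ⟨a, ha, i, hi⟩ := Fintype.not_linearIndependent_iff.1 w.2
        refine ⟨a, fun h => hi (by simp [h]), ?_⟩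
        rw [← ha]
        simp [L]
      choose a ha h using this
      refine Nat.card_le_card_of_injective (fun w => ⟨⟨a w, ha w⟩, ⟨w.1, h w⟩⟩) (fun w w' hh => ?_)
      have := congrArg (fun x : (Σ a : {a : Fin k → F // a ≠ 0}, LinearMap.ker (L a.1)) => (x.2.1)) hh
      exact Subtype.ext this
    have hker : ∀ a : Fin k → F, a ≠ 0 → (Nat.card (LinearMap.ker (L a)) : ℝ) ≤ g * (q^n)^k / q^n := by
      intro a ha
      obtain ⟨i, hi⟩ := Function.ne_iff.1 ha
      have hs : LinearMap.range (∑ i, a i • (LinearMap.proj i : (Fin k → (Fin n → F)) →ₗ[F] (Fin n → F))) = ⊤ := by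
        rw [LinearMap.range_eq_top]
        intro v
        refine ⟨Pi.single i ((a i)⁻¹ • v), ?_⟩
        simp only [LinearMap.sum_apply, LinearMap.smul_apply, LinearMap.proj_apply]
        rw [Finset.sum_eq_single i]
        · simp only [Pi.single_eq_same]; rw [smul_smul, mul_inv_cancel₀ hi, one_smul]
        · intro j _ hj; simp [hj]
        · simp
      have h1 := card_ker_range (L a)
      have h2 := card_ker_range B.mulVecLin
      have h3 : LinearMap.range (L a) = LinearMap.range B.mulVecLin := by
        rw [LinearMap.range_comp, hs, Submodule.map_top]
      rw [h3] at h1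
      have h1' := congrArg (Nat.cast : ℕ → ℝ) h1
      have h2' := congrArg (Nat.cast : ℕ → ℝ) h2
      rw [hV] at h1'
      have hV1 : (Nat.card (Fin n → F) : ℝ) = q^n := by simp [hq]
      rw [hV1] at h2'
      push_cast at h1' h2'
      have hr : 0 < (Nat.card (LinearMap.range B.mulVecLin) : ℝ) := by exact_mod_cast Nat.card_pos
      have hgR : (Nat.card (LinearMap.ker B.mulVecLin) : ℝ) ≤ g := by exact_mod_cast hg
      rw [le_div_iff₀ (by positivity), ← h1', ← h2']
      have : 0 ≤ (Nat.card (LinearMap.ker (L a)) : ℝ) * (Nat.card (LinearMap.range B.mulVecLin) : ℝ) := by positivity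
      nlinarith
    have hsub' : (Nat.card {w : Fin k → (Fin n → F) // ¬ LinearIndependent F (fun i => B.mulVec (w i))} : ℝ) ≤
        ∑ a : {a : Fin k → F // a ≠ 0}, (Nat.card (LinearMap.ker (L a.1)) : ℝ) := by
      rw [Nat.card_sigma] at hsub; exact_mod_cast hsub
    refine hsub'.trans ((Finset.sum_le_sum fun a _ => hker a.1 a.2).trans ?_)
    rw [Finset.sum_const, nsmul_eq_mul]
    refine mul_le_mul_of_nonneg_right ?_ (by positivity)
    have : Fintype.card {a : Fin k → F // a ≠ 0} ≤ Fintype.card (Fin k → F) := Fintype.card_subtype_le _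
    rw [Fintype.card_fun, Fintype.card_fin] at this
    rw [Finset.card_univ, hq]
    exact_mod_cast this
  have htot : (Nat.card {w : Fin k → (Fin n → F) // LinearIndependent F (fun i => B.mulVec (w i))} : ℝ) +
     (Nat.card {w : Fin k → (Fin n → F) // ¬ LinearIndependent F (fun i => B.mulVec (w i))} : ℝ) = (q^n)^k := by
    rw [← hV, ← Nat.card_congr (Equiv.sumCompl (fun w : Fin k → (Fin n → F) => LinearIndependent F (fun i => B.mulVec (w i)))), Nat.card_sum]
    push_cast; rfl
  have hqq : 0 < (q^n)^k := by positivity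
  calc 1 - g * q^k / q^n = ((q^n)^k - q^k * (g * (q^n)^k / q^n)) / (q^n)^k := by field_simp
    _ ≤ (Nat.card {w : Fin k → (Fin n → F) // LinearIndependent F (fun i => B.mulVec (w i))} : ℝ) / (q^n)^k := by
      gcongr; linarith
    _ ≤ _ := by gcongr

/-- error term -/
noncomputable def errT (q : ℝ) (g n : ℕ) : ℝ := ∑' k, |cA q k| * min 1 (g * q^k / q^n)

lemma errT_tendsto (q : ℝ) (hq : 2 ≤ q) (g : ℕ) : Tendsto (errT q g) atTop (𝓝 0) := by
  have h0 : ∑' k : ℕ, |cA q k| * 0 = 0 := by simp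
  rw [← h0]
  have hpos : 0 < q := by linarith
  refine tendsto_tsum_of_dominated_convergence (cA_summable q hq) (fun k => ?_) (Eventually.of_forall fun n k => ?_)
  · refine Tendsto.const_mul _ ?_
    refine squeeze_zero (fun n => by positivity) (fun n => min_le_right _ _) ?_
    exact (tendsto_pow_atTop_atTop_of_one_lt (by linarith)).const_div_atTop _
  · rw [norm_mul, Real.norm_eq_abs, abs_abs]
    refine mul_le_of_le_one_right (abs_nonneg _) ?_
    rw [Real.norm_of_nonneg (by positivity)]
    exact min_le_left _ _

lemma pair_bound (n : ℕ) (hF : (2:ℝ) ≤ Fintype.card F) (B : Matrix (Fin n) (Fin n) F) (g : ℕ)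
    (hg : Nat.card (LinearMap.ker B.mulVecLin) ≤ g) :
    |(Nat.card {U : GL (Fin n) F // (U.1 + B).det ≠ 0} : ℝ) / Nat.card (GL (Fin n) F) -
      ∏' i : ℕ, (1 - (Fintype.card F : ℝ)⁻¹^(i+1))| ≤ errT (Fintype.card F) g n := by
  set q : ℝ := ((Fintype.card F : ℕ) : ℝ) with hqd
  have hGL : (Nat.card (GL (Fin n) F) : ℝ) ≠ 0 := by exact_mod_cast Nat.card_pos.ne'
  have hg1 : (1:ℝ) ≤ g := by
    have : 0 < Nat.card (LinearMap.ker B.mulVecLin) := Nat.card_pos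
    exact_mod_cast (by omega : 1 ≤ g)
  rw [pair_count n hF B, mul_div_cancel_left₀ _ hGL, ← cA_tsum q hF]
  let t : ℕ → ℝ := fun k => if k ≤ n then ((Nat.card {w : Fin k → (Fin n → F) // LinearIndependent F (fun i => B.mulVec (w i))} : ℝ) /
        Nat.card {s : Fin k → (Fin n → F) // LinearIndependent F s}) else 0
  have hs := cA_summable q hF
  have hqpos : 0 < q := by linarith
  have h1 : ∑ k ∈ Finset.range (n+1), cA (Fintype.card F) k *
       ((Nat.card {w : Fin k → (Fin n → F) // LinearIndependent F (fun i => B.mulVec (w i))} : ℝ) /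
        Nat.card {s : Fin k → (Fin n → F) // LinearIndependent F s}) = ∑' k, cA q k * t k := by
    rw [tsum_eq_sum (s := Finset.range (n+1))]
    · refine Finset.sum_congr rfl fun k hk => ?_
      have : k ≤ n := by simp at hk; omega
      simp [t, this, hqd]
    · intro k hk
      have : ¬ k ≤ n := by simp at hk; omega
      simp [t, this]
  have ht : ∀ k, |t k - 1| ≤ min 1 (g * q^k / q^n) := by
    intro k
    by_cases hk : k ≤ n
    · obtain ⟨a, b⟩ := ratio_bound n k B g hg hk
      simp only [t, hk, if_true]
      rw [abs_of_nonpos (by linarith)]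
      refine le_min ?_ (by linarith)
      have : 0 ≤ ((Nat.card {w : Fin k → (Fin n → F) // LinearIndependent F (fun i => B.mulVec (w i))} : ℝ) /
        Nat.card {s : Fin k → (Fin n → F) // LinearIndependent F s}) := by positivity
      linarith
    · simp only [t, hk, if_false]
      rw [zero_sub, abs_neg, abs_one]
      refine le_min le_rfl ?_
      rw [le_div_iff₀ (by positivity), one_mul]
      have : q^n ≤ q^k := pow_le_pow_right₀ (by linarith) (by omega)
      have : 0 < q^k := by positivity
      nlinarith
  rw [h1]
  have hs' : Summable (cA q) := hs.of_abs
  have hb : Summable (fun k => |cA q k| * min 1 (g * q^k / q^n)) := by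
    refine Summable.of_nonneg_of_le (fun k => by positivity) (fun k => ?_) hs
    exact mul_le_of_le_one_right (abs_nonneg _) (min_le_left _ _)
  have hd : ∀ k, ‖cA q k * (t k - 1)‖ ≤ |cA q k| * min 1 (g * q^k / q^n) := fun k => by
    rw [norm_mul, Real.norm_eq_abs, Real.norm_eq_abs]
    exact mul_le_mul_of_nonneg_left (ht k) (abs_nonneg _)
  have hsd : Summable (fun k => cA q k * (t k - 1)) := Summable.of_norm_bounded hb hd
  have h2 : ∑' k, cA q k * t k - ∑' k, cA q k = ∑' k, cA q k * (t k - 1) := by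
    rw [sub_eq_iff_eq_add, ← hsd.tsum_add hs']
    exact tsum_congr fun k => by ring
  rw [h2, ← Real.norm_eq_abs]
  exact tsum_of_norm_bounded hb.hasSum hd

lemma GL_frac_tendsto (p : ℕ) [Fact p.Prime] : Tendsto (fun n : ℕ => (Nat.card (GL (Fin n) (ZMod p)) : ℝ) / (p:ℝ)^(n*n)) atTop
    (𝓝 (∏' i : ℕ, (1 - (p : ℝ)⁻¹^(i+1)))) := by
  have hp : (2:ℝ) ≤ p := by exact_mod_cast (Fact.out : p.Prime).two_le
  refine (euler_tendsto p hp).congr fun n => ?_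
  have hp0 : (p:ℝ) ≠ 0 := by positivity
  rw [Matrix.card_GL_field, ZMod.card, ← Fin.prod_univ_eq_prod_range (fun i => 1 - (p:ℝ)⁻¹^(i+1)), pow_mul]
  push_cast
  rw [← Fin.prod_const n ((p:ℝ)^n), ← Finset.prod_div_distrib, ← Equiv.prod_comp Fin.revPerm]
  refine Finset.prod_congr rfl fun i _ => ?_
  rw [Nat.cast_sub (Nat.pow_le_pow_right (Fact.out : p.Prime).pos (by omega))]
  push_cast
  rw [sub_div, div_self (by positivity)]
  congr 1
  have : n = (i:ℕ) + (((Fin.revPerm i : Fin n):ℕ) + 1) := by simp [Fin.val_rev]; omega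
  have h : (p:ℝ)^n = (p:ℝ)^(i:ℕ) * (p:ℝ)^(((Fin.revPerm i : Fin n):ℕ) + 1) := by
    rw [← pow_add, ← this]
  rw [inv_pow, eq_div_iff (by positivity), h]
  field_simp
end counting

end analysis

section meas
open Module

lemma unif {A H : Type*} [AddCommGroup A] [MeasurableSpace A] [MeasurableAdd A] [AddCommGroup H] [Finite H]
    (ν : Measure A) [ν.IsAddLeftInvariant] (π : A →+ H) (hs : Function.Surjective π)
    (hm : MeasurableSet (π ⁻¹' {0})) (T : Set H) :
    MeasurableSet (π ⁻¹' T) ∧ ν (π ⁻¹' T) * Nat.card H = Nat.card T * ν Set.univ := by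
  classical
  have := Fintype.ofFinite H
  have hf : ∀ h : H, ∃ a : A, π ⁻¹' {h} = (fun x => a + x) ⁻¹' (π ⁻¹' {0}) := by
    intro h
    obtain ⟨a, ha⟩ := hs (-h)
    refine ⟨a, ?_⟩
    ext x
    simp only [Set.mem_preimage, Set.mem_singleton_iff, map_add, ha]
    rw [neg_add_eq_zero, eq_comm]
  have hmeas : ∀ h : H, MeasurableSet (π ⁻¹' {h}) := by
    intro h
    obtain ⟨a, ha⟩ := hf h
    rw [ha]
    exact (measurable_const_add a) hm
  have hc : ∀ h : H, ν (π ⁻¹' {h}) = ν (π ⁻¹' {0}) := by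
    intro h
    obtain ⟨a, ha⟩ := hf h
    rw [ha, measure_preimage_add]
  have hU : ∀ S : Set H, π ⁻¹' S = ⋃ h ∈ S.toFinset, π ⁻¹' {h} := by
    intro S; ext x; simp
  have hT : ∀ S : Set H, ν (π ⁻¹' S) = Nat.card S * ν (π ⁻¹' {0}) := by
    intro S
    rw [hU S, measure_biUnion_finset]
    · rw [Finset.sum_congr rfl fun h _ => hc h]
      simp [Set.toFinset_card, Nat.card_eq_fintype_card]
    · intro a _ b _ hab
      exact Disjoint.preimage _ (by simpa using hab)
    · exact fun h _ => hmeas h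
  refine ⟨?_, ?_⟩
  · rw [hU]; exact Finset.measurableSet_biUnion _ fun h _ => hmeas h
  · have := hT Set.univ
    rw [Set.preimage_univ] at this
    rw [hT T, this]
    rw [Nat.card_congr (Equiv.Set.univ H)]
    ring

variable {p : ℕ} [Fact p.Prime]

instance : BorelSpace ℤ_[p] := ⟨rfl⟩

lemma isUnit_iff_toZMod (x : ℤ_[p]) : IsUnit x ↔ PadicInt.toZMod x ≠ 0 := by
  rw [← not_iff_not, not_not, ← RingHom.mem_ker, PadicInt.ker_toZMod, IsLocalRing.mem_maximalIdeal, mem_nonunits_iff]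

lemma range_top_iff {n : ℕ} (M : Matrix (Fin n) (Fin n) ℤ_[p]) :
    LinearMap.range M.mulVecLin = ⊤ ↔ (M.map PadicInt.toZMod).det ≠ 0 := by
  rw [LinearMap.range_eq_top, Matrix.coe_mulVecLin, Matrix.mulVec_surjective_iff_isUnit, Matrix.isUnit_iff_isUnit_det,
    isUnit_iff_toZMod, RingHom.map_det]
  rfl

lemma exists_B {G : Type} [AddCommGroup G] [Finite G] [Module ℤ_[p] G] {n : ℕ}
    (φ : (Fin n → ℤ_[p]) →ₗ[ℤ_[p]] G) (hφ : Function.Surjective φ) :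
    ∃ B : Matrix (Fin n) (Fin n) ℤ_[p], Function.Injective B.mulVecLin ∧ LinearMap.range B.mulVecLin = LinearMap.ker φ := by
  have htor : Module.IsTorsion ℤ_[p] G := by
    intro x
    refine ⟨⟨(Nat.card G : ℤ_[p]), mem_nonZeroDivisors_of_ne_zero (by exact_mod_cast Nat.card_pos.ne')⟩, ?_⟩
    change (Nat.card G : ℤ_[p]) • x = 0
    rw [Nat.cast_smul_eq_nsmul, card_nsmul_eq_zero']
  have h1 := Submodule.finrank_quotient_add_finrank (LinearMap.ker φ)
  rw [(φ.quotKerEquivOfSurjective hφ).finrank_eq, Module.finrank_eq_zero_iff_isTorsion.2 htor, zero_add] at h1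
  let e : (Fin n → ℤ_[p]) ≃ₗ[ℤ_[p]] LinearMap.ker φ := LinearEquiv.ofFinrankEq _ _ h1.symm
  let f : (Fin n → ℤ_[p]) →ₗ[ℤ_[p]] (Fin n → ℤ_[p]) := (LinearMap.ker φ).subtype ∘ₗ e.toLinearMap
  refine ⟨LinearMap.toMatrix' f, ?_, ?_⟩
  · rw [← Matrix.toLin'_apply', Matrix.toLin'_toMatrix']
    exact (Subtype.val_injective).comp e.injective
  · rw [← Matrix.toLin'_apply', Matrix.toLin'_toMatrix', LinearMap.range_comp]
    simp

lemma ker_card_le {G : Type} [AddCommGroup G] [Finite G] [Module ℤ_[p] G] {n : ℕ}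
    (φ : (Fin n → ℤ_[p]) →ₗ[ℤ_[p]] G) (B : Matrix (Fin n) (Fin n) ℤ_[p])
    (hB : LinearMap.range B.mulVecLin = LinearMap.ker φ) :
    Nat.card (LinearMap.ker (B.map PadicInt.toZMod).mulVecLin) ≤ Nat.card G := by
  set C := (B.map (PadicInt.toZMod (p := p))) with hC
  have h1 : Nat.card (LinearMap.ker C.mulVecLin) * Nat.card (LinearMap.range C.mulVecLin) = Nat.card (Fin n → ZMod p) := by
    rw [Submodule.card_eq_card_quotient_mul_card (LinearMap.ker C.mulVecLin), Nat.card_congr C.mulVecLin.quotKerEquivRange.toEquiv, mul_comm]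
  rw [Submodule.card_eq_card_quotient_mul_card (LinearMap.range C.mulVecLin), mul_comm] at h1
  have h2 := Nat.eq_of_mul_eq_mul_left Nat.card_pos h1
  rw [h2]
  have hl : ∀ c : (Fin n → ZMod p) ⧸ LinearMap.range C.mulVecLin, ∃ x : Fin n → ℤ_[p],
      (LinearMap.range C.mulVecLin).mkQ (fun i => PadicInt.toZMod (x i)) = c := by
    intro c
    obtain ⟨y, rfl⟩ := Submodule.mkQ_surjective _ c
    choose x hx using fun i => ZMod.ringHom_surjective (PadicInt.toZMod (p := p)) (y i)
    exact ⟨x, by simp [hx]⟩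
  choose x hx using hl
  refine Nat.card_le_card_of_injective (fun c => φ (x c)) (fun c c' h => ?_)
  have h3 : x c - x c' ∈ LinearMap.ker φ := by simpa [sub_eq_zero] using h
  rw [← hB] at h3
  obtain ⟨z, hz⟩ := h3
  rw [← hx c, ← hx c', ← sub_eq_zero, ← map_sub, Submodule.mkQ_apply, Submodule.Quotient.mk_eq_zero]
  refine ⟨fun i => PadicInt.toZMod (z i), ?_⟩
  ext i
  have := congrArg PadicInt.toZMod (congrFun hz i)
  simp only [Matrix.mulVecLin_apply, Pi.sub_apply, map_sub] at this ⊢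
  rw [← this, hC, RingHom.map_mulVec]
  rfl

/-- left multiplication by a matrix -/
noncomputable def mulL {n : ℕ} (B : Matrix (Fin n) (Fin n) ℤ_[p]) :
    (Fin n → Fin n → ℤ_[p]) →+ (Fin n → Fin n → ℤ_[p]) where
  toFun := fun Z => (B * Matrix.of Z : Matrix (Fin n) (Fin n) ℤ_[p])
  map_zero' := by change B * (0 : Matrix (Fin n) (Fin n) ℤ_[p]) = 0; simp
  map_add' := fun X Y => Matrix.mul_add B (Matrix.of X) (Matrix.of Y)

lemma mulL_cont {n : ℕ} (B : Matrix (Fin n) (Fin n) ℤ_[p]) : Continuous (mulL B) := by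
  refine continuous_pi fun i => continuous_pi fun j => ?_
  change Continuous fun Z : Fin n → Fin n → ℤ_[p] => (B * Matrix.of Z) i j
  simp only [Matrix.mul_apply, Matrix.of_apply]
  fun_prop

lemma mulL_range_meas {n : ℕ} (B : Matrix (Fin n) (Fin n) ℤ_[p]) : MeasurableSet (Set.range (mulL B)) :=
  (isCompact_range (mulL_cont B)).isClosed.measurableSet

/-- reduction mod p -/
noncomputable def redP (n : ℕ) : (Fin n → Fin n → ℤ_[p]) →+ Matrix (Fin n) (Fin n) (ZMod p) where
  toFun := fun Z => (Matrix.of Z).map PadicInt.toZMod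
  map_zero' := by ext; simp
  map_add' := fun X Y => by ext; simp

lemma redP_surj (n : ℕ) : Function.Surjective (redP (p := p) n) := by
  intro M
  choose x hx using fun i j => ZMod.ringHom_surjective (PadicInt.toZMod (p := p)) (M i j)
  exact ⟨x, by ext i j; simp [redP, hx]⟩

lemma redP_ker (n : ℕ) : MeasurableSet (redP (p := p) n ⁻¹' {0}) := by
  have : redP (p := p) n ⁻¹' {0} = Set.range (mulL ((p : ℤ_[p]) • (1 : Matrix (Fin n) (Fin n) ℤ_[p]))) := by
    ext Z
    simp only [Set.mem_preimage, Set.mem_singleton_iff, Set.mem_range]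
    have hd : ∀ x : ℤ_[p], PadicInt.toZMod x = 0 ↔ ∃ y, (p : ℤ_[p]) * y = x := by
      intro x
      rw [← RingHom.mem_ker, PadicInt.ker_toZMod, PadicInt.maximalIdeal_eq_span_p, Ideal.mem_span_singleton]
      exact ⟨fun ⟨y, hy⟩ => ⟨y, hy.symm⟩, fun ⟨y, hy⟩ => ⟨y, hy.symm⟩⟩
    have hpm : ∀ (y : Fin n → Fin n → ℤ_[p]) i j, mulL ((p : ℤ_[p]) • (1 : Matrix (Fin n) (Fin n) ℤ_[p])) y i j = p * y i j := by
      intro y i j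
      change (((p : ℤ_[p]) • (1 : Matrix (Fin n) (Fin n) ℤ_[p])) * Matrix.of y) i j = _
      rw [Matrix.smul_mul, one_mul]; rfl
    constructor
    · intro h
      have : ∀ i j, ∃ y, (p : ℤ_[p]) * y = Z i j := fun i j => (hd _).1 (by
        simpa [redP] using congrFun (congrFun h i) j)
      choose y hy using this
      refine ⟨y, ?_⟩
      ext i j
      rw [hpm, hy]
    · rintro ⟨y, rfl⟩
      ext i j
      change PadicInt.toZMod (mulL _ y i j) = 0
      rw [hpm]; simp
  rw [this]
  exact mulL_range_meas _

/-- apply φ to each column -/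
noncomputable def colP {G : Type} [AddCommGroup G] [Module ℤ_[p] G] {n : ℕ}
    (φ : (Fin n → ℤ_[p]) →ₗ[ℤ_[p]] G) : (Fin n → Fin n → ℤ_[p]) →+ (Fin n → G) where
  toFun := fun Z j => φ (fun i => Z i j)
  map_zero' := by ext j; exact φ.map_zero
  map_add' := fun X Y => by ext j; exact φ.map_add (fun i => X i j) (fun i => Y i j)

lemma colP_ker {G : Type} [AddCommGroup G] [Module ℤ_[p] G] {n : ℕ}
    (φ : (Fin n → ℤ_[p]) →ₗ[ℤ_[p]] G) (B : Matrix (Fin n) (Fin n) ℤ_[p])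
    (hB : LinearMap.range B.mulVecLin = LinearMap.ker φ) :
    colP φ ⁻¹' {0} = Set.range (mulL B) := by
  ext Z
  simp only [Set.mem_preimage, Set.mem_singleton_iff, Set.mem_range]
  constructor
  · intro h
    have : ∀ j, ∃ y, B.mulVecLin y = fun i => Z i j := fun j => by
      have h2 : (fun i => Z i j) ∈ LinearMap.ker φ := congrFun h j
      rw [← hB] at h2
      exact h2
    choose y hy using this
    refine ⟨fun i j => y j i, ?_⟩
    ext i j
    exact congrFun (hy j) i
  · rintro ⟨y, rfl⟩
    ext j
    have : (fun i => mulL B y i j) ∈ LinearMap.ker φ := by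
      rw [← hB]
      exact ⟨fun i => y i j, rfl⟩
    exact this

lemma card_T {n : ℕ} (C : Matrix (Fin n) (Fin n) (ZMod p)) :
    Nat.card {Z : Matrix (Fin n) (Fin n) (ZMod p) | Z.det ≠ 0 ∧ (C * Z + 1).det ≠ 0} =
    Nat.card {U : GL (Fin n) (ZMod p) // (U.1 + C).det ≠ 0} := by
  have key : ∀ U : GL (Fin n) (ZMod p), (C * U.1 + 1).det = ((U⁻¹).1 + C).det * U.1.det := by
    intro U
    rw [← Matrix.det_mul, add_mul, ← Units.val_mul, inv_mul_cancel, add_comm]; rfl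
  have hdU : ∀ U : GL (Fin n) (ZMod p), U.1.det ≠ 0 := fun U => by
    rw [← isUnit_iff_ne_zero, ← Matrix.isUnit_iff_isUnit_det]; exact U.isUnit
  refine Nat.card_congr
   { toFun := fun Z => ⟨(Matrix.GeneralLinearGroup.mkOfDetNeZero Z.1 Z.2.1)⁻¹, ?_⟩
     invFun := fun U => ⟨(U.1⁻¹).1, hdU _, ?_⟩
     left_inv := ?_
     right_inv := ?_ }
  · intro h
    apply Z.2.2
    have := key (Matrix.GeneralLinearGroup.mkOfDetNeZero Z.1 Z.2.1)
    rw [h, zero_mul] at this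
    exact this
  · rw [key, inv_inv]
    exact mul_ne_zero U.2 (hdU _)
  · intro Z
    apply Subtype.ext
    simp only [inv_inv]
    rfl
  · intro U
    apply Subtype.ext
    simp only
    rw [inv_eq_iff_eq_inv]
    apply Units.ext
    rfl

lemma piece {G : Type} [AddCommGroup G] [Finite G] [Module ℤ_[p] G] {n : ℕ}
    (μ : Measure (Fin n → Fin n → ℤ_[p])) [IsProbabilityMeasure μ] [μ.IsAddHaarMeasure]
    (φ : (Fin n → ℤ_[p]) →ₗ[ℤ_[p]] G) (hφ : Function.Surjective φ) :
    ∃ C : Matrix (Fin n) (Fin n) (ZMod p), Nat.card (LinearMap.ker C.mulVecLin) ≤ Nat.card G ∧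
      MeasurableSet {X : Fin n → Fin n → ℤ_[p] | LinearMap.range (Matrix.of X).mulVecLin = ⊤ ∧
        LinearMap.range (Matrix.of X - 1).mulVecLin = LinearMap.ker φ} ∧
      (μ {X : Fin n → Fin n → ℤ_[p] | LinearMap.range (Matrix.of X).mulVecLin = ⊤ ∧
        LinearMap.range (Matrix.of X - 1).mulVecLin = LinearMap.ker φ}).toReal =
      (Nat.card {U : GL (Fin n) (ZMod p) // (U.1 + C).det ≠ 0} : ℝ) / ((Nat.card G : ℝ)^n * (p:ℝ)^(n*n)) := by
  obtain ⟨B, hBi, hB⟩ := exists_B φ hφ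
  set C := (B.map (PadicInt.toZMod (p := p))) with hC
  refine ⟨C, ker_card_le φ B hB, ?_⟩
  set T : Set (Matrix (Fin n) (Fin n) (ZMod p)) := {Z | Z.det ≠ 0 ∧ (C * Z + 1).det ≠ 0} with hT
  have hinj : Function.Injective (mulL B) := by
    intro X Y h
    ext i j
    have : B.mulVecLin (fun i => X i j) = B.mulVecLin (fun i => Y i j) := by
      ext i; exact congrFun (congrFun h i) j
    exact congrFun (hBi this) i
  have hemb : MeasurableEmbedding (mulL B) := ((mulL_cont B).isClosedEmbedding hinj).measurableEmbedding
  let one' : Fin n → Fin n → ℤ_[p] := (1 : Matrix (Fin n) (Fin n) ℤ_[p])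
  have hset : {X : Fin n → Fin n → ℤ_[p] | LinearMap.range (Matrix.of X).mulVecLin = ⊤ ∧
        LinearMap.range (Matrix.of X - 1).mulVecLin = LinearMap.ker φ} =
      (fun X => -one' + X) ⁻¹' (mulL B '' (redP n ⁻¹' T)) := by
    have hZ : ∀ Z : Matrix (Fin n) (Fin n) ℤ_[p],
        (LinearMap.range (B * Z).mulVecLin = LinearMap.ker φ ↔ (Z.map (PadicInt.toZMod)).det ≠ 0) ∧
        (LinearMap.range (B * Z + 1).mulVecLin = ⊤ ↔ (C * Z.map (PadicInt.toZMod) + 1).det ≠ 0) := by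
      intro Z
      constructor
      · rw [← range_top_iff, Matrix.mulVecLin_mul, LinearMap.range_comp, ← hB]
        have htop := Submodule.map_top B.mulVecLin
        rw [← htop]
        exact (Submodule.map_injective_of_injective hBi).eq_iff
      · rw [range_top_iff]
        have : (B * Z + 1).map (PadicInt.toZMod (p := p)) = C * Z.map (PadicInt.toZMod) + 1 := by
          have := map_add (PadicInt.toZMod (p := p)).mapMatrix (B * Z) 1
          rw [map_mul, map_one] at this
          exact this
        rw [this]
    ext X
    simp only [Set.mem_ofPred_eq, Set.mem_preimage, Set.mem_image]
    constructor
    · rintro ⟨h1, h2⟩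
      have h3 : (-one' + X) ∈ Set.range (mulL B) := by
        rw [← colP_ker φ B hB]
        ext j
        have : (fun i => (-one' + X) i j) ∈ LinearMap.ker φ := by
          rw [← h2]
          refine ⟨Pi.single j 1, ?_⟩
          rw [Matrix.mulVecLin_apply, Matrix.mulVec_single_one]
          ext i
          change X i j - (1 : Matrix (Fin n) (Fin n) ℤ_[p]) i j = -(1 : Matrix (Fin n) (Fin n) ℤ_[p]) i j + X i j
          ring
        exact this
      obtain ⟨Z, hZe⟩ := h3
      refine ⟨Z, ?_, hZe⟩
      have e1 : B * Matrix.of Z = Matrix.of X - 1 := by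
        change mulL B Z = X - one'
        rw [hZe]; abel
      have e2 : B * Matrix.of Z + 1 = Matrix.of X := by rw [e1]; abel
      rw [← e1] at h2
      rw [← e2] at h1
      exact ⟨(hZ _).1.1 h2, (hZ _).2.1 h1⟩
    · rintro ⟨Z, hZT, hZe⟩
      have e1 : B * Matrix.of Z = Matrix.of X - 1 := by
        change mulL B Z = X - one'
        rw [hZe]; abel
      have e2 : B * Matrix.of Z + 1 = Matrix.of X := by rw [e1]; abel
      rw [← e1, ← e2]
      exact ⟨(hZ _).2.2 hZT.2, (hZ _).1.2 hZT.1⟩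
  let ν := μ.comap (mulL B)
  have hν : ν.IsAddLeftInvariant := Measure.IsAddLeftInvariant.comap μ hemb
  obtain ⟨hm, hcard⟩ := unif ν (redP n) (redP_surj n) (redP_ker n) T
  have hsurj : Function.Surjective (colP φ) := by
    intro g
    choose x hx using fun j => hφ (g j)
    exact ⟨fun i j => x j i, funext fun j => hx j⟩
  have hk := colP_ker φ B hB
  obtain ⟨-, hG⟩ := unif μ (colP φ) hsurj (by rw [hk]; exact mulL_range_meas B) {0}
  rw [hk] at hG
  rw [hset, measure_preimage_add]
  refine ⟨(measurable_const_add _) (hemb.measurableSet_image.2 hm), ?_⟩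
  rw [hemb.comap_apply, hemb.comap_apply, Set.image_univ, card_T] at hcard
  have hcR := congrArg ENNReal.toReal hcard
  have hGR := congrArg ENNReal.toReal hG
  simp only [ENNReal.toReal_mul, ENNReal.toReal_natCast, measure_univ, ENNReal.toReal_one] at hcR hGR
  have e3 : (Nat.card (Matrix (Fin n) (Fin n) (ZMod p)) : ℝ) = (p:ℝ)^(n*n) := by
    have : Nat.card (Matrix (Fin n) (Fin n) (ZMod p)) = Nat.card (Fin n → Fin n → ZMod p) := rfl
    rw [this]; simp [pow_mul]
  have e4 : (Nat.card (Fin n → G) : ℝ) = (Nat.card G : ℝ)^n := by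
    rw [Nat.card_fun, Nat.card_fin]; push_cast; rfl
  rw [e3] at hcR
  rw [e4] at hGR
  have hp0 : (p:ℝ) ≠ 0 := by exact_mod_cast (Fact.out : p.Prime).ne_zero
  have hG0 : (Nat.card G : ℝ) ≠ 0 := by exact_mod_cast Nat.card_pos.ne'
  rw [eq_div_iff (by positivity)]
  simp at hGR
  linear_combination (Nat.card G : ℝ)^n * hcR + (Nat.card {U : GL (Fin n) (ZMod p) // (U.1 + C).det ≠ 0} : ℝ) * hGR
end meas

section assembly
open Module Filter Topology
variable {p : ℕ} [Fact p.Prime]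

lemma exists_module (G : Type) [AddCommGroup G] (hG : ∃ k : ℕ, ∀ x : G, (p ^ k : ℕ) • x = 0) :
    ∃ _inst : Module ℤ_[p] G, ∀ (M : Type) [AddCommGroup M] [Module ℤ_[p] M] (f : M →+ G) (a : ℤ_[p]) (m : M),
      f (a • m) = a • f m := by
  obtain ⟨k, hk⟩ := hG
  letI m1 : Module (ZMod (p^k)) G := AddCommGroup.zmodModule hk
  letI m2 : Module ℤ_[p] G := Module.compHom G (PadicInt.toZModPow (p := p) k)
  refine ⟨m2, ?_⟩
  intro M _ _ f a m
  have h1 : a • f m = (PadicInt.toZModPow k a) • f m := rfl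
  have : NeZero (p^k) := ⟨pow_ne_zero _ (Fact.out : p.Prime).ne_zero⟩
  set N : ℕ := (PadicInt.toZModPow k a).val with hN
  have h2 : PadicInt.toZModPow k a = (N : ZMod (p^k)) := by simp [hN]
  have h3 : a - (N : ℤ_[p]) ∈ RingHom.ker (PadicInt.toZModPow (p := p) k) := by
    rw [RingHom.mem_ker, map_sub, map_natCast, h2, sub_self]
  rw [PadicInt.ker_toZModPow, Ideal.mem_span_singleton] at h3
  obtain ⟨b, hb⟩ := h3
  have h4 : a • m = N • m + (p^k : ℕ) • (b • m) := by
    rw [← Nat.cast_smul_eq_nsmul ℤ_[p] N, ← Nat.cast_smul_eq_nsmul ℤ_[p] (p^k), smul_smul, ← add_smul]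
    congr 1
    push_cast
    rw [← hb]; ring
  rw [h4, map_add, map_nsmul, map_nsmul, hk, add_zero, h1, h2, Nat.cast_smul_eq_nsmul]

variable {G : Type} [AddCommGroup G] [Finite G] [Module ℤ_[p] G]

lemma card_hom (n : ℕ) : Nat.card ((Fin n → ℤ_[p]) →ₗ[ℤ_[p]] G) = Nat.card G ^ n := by
  rw [← Nat.card_congr ((Pi.basisFun ℤ_[p] (Fin n)).constr ℤ_[p] (M' := G)).toEquiv, Nat.card_fun, Nat.card_fin]

instance finite_hom (n : ℕ) : Finite ((Fin n → ℤ_[p]) →ₗ[ℤ_[p]] G) :=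
  Finite.of_equiv _ ((Pi.basisFun ℤ_[p] (Fin n)).constr ℤ_[p] (M' := G)).toEquiv

lemma nonsurj_bound (n : ℕ) :
    (Nat.card {φ : (Fin n → ℤ_[p]) →ₗ[ℤ_[p]] G // ¬ Function.Surjective φ} : ℝ) ≤
      Nat.card (Submodule ℤ_[p] G) * ((Nat.card G : ℝ) / 2)^n := by
  classical
  have hfin : Finite (Submodule ℤ_[p] G) := Finite.of_injective (fun N => (N : Set G)) SetLike.coe_injective
  have := Fintype.ofFinite (Submodule ℤ_[p] G)
  have h1 : Nat.card {φ : (Fin n → ℤ_[p]) →ₗ[ℤ_[p]] G // ¬ Function.Surjective φ} ≤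
      Nat.card (Σ N : {N : Submodule ℤ_[p] G // N ≠ ⊤}, (Fin n → N.1)) := by
    refine Nat.card_le_card_of_injective (fun φ => ⟨⟨LinearMap.range φ.1, fun h => φ.2 (LinearMap.range_eq_top.1 h)⟩,
      fun i => ⟨φ.1 (Pi.basisFun ℤ_[p] (Fin n) i), ⟨_, rfl⟩⟩⟩) ?_
    intro φ ψ h
    have := congrArg (fun x : (Σ N : {N : Submodule ℤ_[p] G // N ≠ ⊤}, (Fin n → N.1)) => fun i => (x.2 i : G)) h
    apply Subtype.ext
    exact (Pi.basisFun ℤ_[p] (Fin n)).ext fun i => congrFun this i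
  rw [Nat.card_sigma] at h1
  have h2 : ∀ N : {N : Submodule ℤ_[p] G // N ≠ ⊤}, (Nat.card (Fin n → N.1) : ℝ) ≤ ((Nat.card G : ℝ) / 2)^n := by
    intro N
    rw [Nat.card_fun, Nat.card_fin]
    push_cast
    refine pow_le_pow_left₀ (by positivity) ?_ n
    have h3 := Submodule.card_eq_card_quotient_mul_card N.1
    have h4 : 2 ≤ Nat.card (G ⧸ N.1) := by
      have : Nontrivial (G ⧸ N.1) := Submodule.Quotient.nontrivial_iff.2 N.2
      have : Finite (G ⧸ N.1) := Finite.of_surjective _ N.1.mkQ_surjective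
      have := Finite.one_lt_card (α := G ⧸ N.1)
      omega
    have h5 : 2 * Nat.card N.1 ≤ Nat.card G := by rw [h3]; nlinarith
    have h6 : (2:ℝ) * Nat.card N.1 ≤ Nat.card G := by exact_mod_cast h5
    linarith
  calc _ ≤ ∑ N : {N : Submodule ℤ_[p] G // N ≠ ⊤}, (Nat.card (Fin n → N.1) : ℝ) := by exact_mod_cast h1
    _ ≤ ∑ N : {N : Submodule ℤ_[p] G // N ≠ ⊤}, ((Nat.card G : ℝ) / 2)^n := Finset.sum_le_sum fun N _ => h2 N
    _ ≤ _ := by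
      rw [Finset.sum_const, nsmul_eq_mul]
      refine mul_le_mul_of_nonneg_right ?_ (by positivity)
      rw [Finset.card_univ, Nat.card_eq_fintype_card]
      exact_mod_cast Fintype.card_subtype_le _

lemma surj_tendsto : Tendsto (fun n => (Nat.card {φ : (Fin n → ℤ_[p]) →ₗ[ℤ_[p]] G // Function.Surjective φ} : ℝ) / (Nat.card G : ℝ)^n)
    atTop (𝓝 1) := by
  classical
  have hG0 : (0:ℝ) < Nat.card G := by exact_mod_cast Nat.card_pos
  have htot : ∀ n, (Nat.card {φ : (Fin n → ℤ_[p]) →ₗ[ℤ_[p]] G // Function.Surjective φ} : ℝ) +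
      Nat.card {φ : (Fin n → ℤ_[p]) →ₗ[ℤ_[p]] G // ¬ Function.Surjective φ} = (Nat.card G : ℝ)^n := by
    intro n
    have h := card_hom (p := p) (G := G) n
    rw [← Nat.card_congr (Equiv.sumCompl (fun φ : (Fin n → ℤ_[p]) →ₗ[ℤ_[p]] G => Function.Surjective φ)), Nat.card_sum] at h
    exact_mod_cast h
  have hlow : Tendsto (fun n : ℕ => 1 - (Nat.card (Submodule ℤ_[p] G) : ℝ) * (1/2)^n) atTop (𝓝 1) := by
    have := ((tendsto_pow_atTop_nhds_zero_of_lt_one (r := (1/2:ℝ)) (by norm_num) (by norm_num)).const_mul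
      (Nat.card (Submodule ℤ_[p] G) : ℝ)).const_sub 1
    simpa using this
  refine tendsto_of_tendsto_of_tendsto_of_le_of_le hlow tendsto_const_nhds (fun n => ?_) (fun n => ?_)
  · have := nonsurj_bound (p := p) (G := G) n
    have h2 := htot n
    change _ ≤ _ / _
    rw [le_div_iff₀ (by positivity), sub_mul, one_mul, mul_assoc, ← mul_pow]
    rw [div_eq_inv_mul] at this
    norm_num at this ⊢
    linarith
  · have h2 := htot n
    change _ / _ ≤ (1:ℝ)
    rw [div_le_one (by positivity), ← h2]
    have : (0:ℝ) ≤ Nat.card {φ : (Fin n → ℤ_[p]) →ₗ[ℤ_[p]] G // ¬ Function.Surjective φ} := by positivity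
    linarith

lemma card_fib (hlin : ∀ (M : Type) [AddCommGroup M] [Module ℤ_[p] M] (f : M →+ G) (a : ℤ_[p]) (m : M),
      f (a • m) = a • f m) {n : ℕ} (N : Submodule ℤ_[p] (Fin n → ℤ_[p])) (e : ((Fin n → ℤ_[p]) ⧸ N) ≃+ G) :
    Nat.card {φ : {φ : (Fin n → ℤ_[p]) →ₗ[ℤ_[p]] G // Function.Surjective φ} // N = LinearMap.ker φ.1} = Nat.card (G ≃+ G) := by
  let F : (((Fin n → ℤ_[p]) ⧸ N) ≃+ G) → {φ : {φ : (Fin n → ℤ_[p]) →ₗ[ℤ_[p]] G // Function.Surjective φ} // N = LinearMap.ker φ.1} :=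
    fun f => ⟨⟨{ toFun := fun x => f (N.mkQ x), map_add' := fun x y => by simp, map_smul' := fun a x => by
                  rw [map_smul]; exact hlin _ f.toAddMonoidHom a _ }, f.surjective.comp N.mkQ_surjective⟩, by
              ext x
              simp [LinearMap.mem_ker]⟩
  have hF : Function.Bijective F := by
    constructor
    · intro f g h
      ext x
      obtain ⟨y, rfl⟩ := N.mkQ_surjective x
      exact congrArg (fun φ : {φ : {φ : (Fin n → ℤ_[p]) →ₗ[ℤ_[p]] G // Function.Surjective φ} // N = LinearMap.ker φ.1} => φ.1.1 y) h
    · rintro ⟨⟨φ, hφ⟩, rfl⟩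
      refine ⟨(φ.quotKerEquivOfSurjective hφ).toAddEquiv, ?_⟩
      apply Subtype.ext
      apply Subtype.ext
      ext x
      rfl
  rw [← Nat.card_congr (Equiv.ofBijective F hF)]
  exact Nat.card_congr ⟨fun f => e.symm.trans f, fun g => e.trans g, fun f => by ext; simp, fun g => by ext; simp⟩

lemma prob_eq (hlin : ∀ (M : Type) [AddCommGroup M] [Module ℤ_[p] M] (f : M →+ G) (a : ℤ_[p]) (m : M),
      f (a • m) = a • f m) {n : ℕ}
    (μ : Measure (Fin n → Fin n → ℤ_[p])) [IsProbabilityMeasure μ] [μ.IsAddHaarMeasure] :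
    |(Nat.card (G ≃+ G) : ℝ) * (μ {X | LinearMap.range (Matrix.of X).mulVecLin = ⊤ ∧
        Nonempty (((Fin n → ℤ_[p]) ⧸ LinearMap.range (Matrix.of X - 1).mulVecLin) ≃+ G)}).toReal -
      ((Nat.card {φ : (Fin n → ℤ_[p]) →ₗ[ℤ_[p]] G // Function.Surjective φ} : ℝ) / (Nat.card G : ℝ)^n) *
       (((Nat.card (GL (Fin n) (ZMod p)) : ℝ) / (p:ℝ)^(n*n)) * (∏' i : ℕ, (1 - (p : ℝ)⁻¹^(i+1))))| ≤
     ((Nat.card {φ : (Fin n → ℤ_[p]) →ₗ[ℤ_[p]] G // Function.Surjective φ} : ℝ) / (Nat.card G : ℝ)^n) *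
       (((Nat.card (GL (Fin n) (ZMod p)) : ℝ) / (p:ℝ)^(n*n)) * errT p (Nat.card G) n) := by
  classical
  have hp : (2:ℝ) ≤ p := by exact_mod_cast (Fact.out : p.Prime).two_le
  have := Fintype.ofFinite {φ : (Fin n → ℤ_[p]) →ₗ[ℤ_[p]] G // Function.Surjective φ}
  set S := {X : Fin n → Fin n → ℤ_[p] | LinearMap.range (Matrix.of X).mulVecLin = ⊤ ∧
        Nonempty (((Fin n → ℤ_[p]) ⧸ LinearMap.range (Matrix.of X - 1).mulVecLin) ≃+ G)} with hS
  choose C hC1 hC2 hC3 using fun φ : {φ : (Fin n → ℤ_[p]) →ₗ[ℤ_[p]] G // Function.Surjective φ} => piece μ φ.1 φ.2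
  set E : {φ : (Fin n → ℤ_[p]) →ₗ[ℤ_[p]] G // Function.Surjective φ} → Set (Fin n → Fin n → ℤ_[p]) :=
    fun φ => {X | LinearMap.range (Matrix.of X).mulVecLin = ⊤ ∧
        LinearMap.range (Matrix.of X - 1).mulVecLin = LinearMap.ker φ.1} with hE
  have hSU : S = ⋃ φ, E φ := by
    ext X
    simp only [Set.mem_iUnion]
    constructor
    · rintro ⟨h1, ⟨e⟩⟩
      have hc := card_fib hlin _ e
      have : Nonempty {φ : {φ : (Fin n → ℤ_[p]) →ₗ[ℤ_[p]] G // Function.Surjective φ} // LinearMap.range (Matrix.of X - 1).mulVecLin = LinearMap.ker φ.1} := by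
        by_contra hne
        rw [not_nonempty_iff] at hne
        rw [Nat.card_of_isEmpty] at hc
        have : 0 < Nat.card (G ≃+ G) := Nat.card_pos
        omega
      obtain ⟨φ, hφ⟩ := this
      exact ⟨φ, h1, hφ⟩
    · rintro ⟨φ, h1, h2⟩
      refine ⟨h1, ⟨?_⟩⟩
      rw [h2]
      exact (φ.1.quotKerEquivOfSurjective φ.2).toAddEquiv
  have hSm : MeasurableSet S := by
    rw [hSU]; exact MeasurableSet.iUnion fun φ => hC2 φ
  have hsum : ∑ φ, μ (E φ) = Nat.card (G ≃+ G) * μ S := by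
    have h1 : ∀ φ, μ (E φ) = ∫⁻ X, (E φ).indicator 1 X ∂μ := fun φ => (lintegral_indicator_one (hC2 φ)).symm
    rw [← lintegral_indicator_one hSm, ← lintegral_const_mul _ (measurable_one.indicator hSm)]
    simp_rw [h1]
    rw [← lintegral_finsetSum _ (fun φ _ => measurable_one.indicator (hC2 φ))]
    congr 1
    ext X
    by_cases hX : X ∈ S
    · obtain ⟨h1, ⟨e⟩⟩ := hX
      have hc := card_fib hlin _ e
      rw [← hc, Set.indicator_of_mem (show X ∈ S from ⟨h1, ⟨e⟩⟩), Nat.card_eq_fintype_card, Fintype.card_subtype]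
      simp [Set.indicator_apply, hE, h1, Finset.sum_boole]
    · have : ∀ φ, X ∉ E φ := fun φ h => hX (by rw [hSU]; exact Set.mem_iUnion.2 ⟨φ, h⟩)
      rw [Set.indicator_of_notMem hX, mul_zero]
      exact Finset.sum_eq_zero fun φ _ => Set.indicator_of_notMem (this φ) _
  have hsumR : ∑ φ, (μ (E φ)).toReal = (Nat.card (G ≃+ G) : ℝ) * (μ S).toReal := by
    have := congrArg ENNReal.toReal hsum
    rw [ENNReal.toReal_sum (fun φ _ => measure_ne_top _ _), ENNReal.toReal_mul, ENNReal.toReal_natCast] at this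
    exact this
  rw [← hsumR]
  have hG0 : (0:ℝ) < Nat.card G := by exact_mod_cast Nat.card_pos
  have hGL : (0:ℝ) < Nat.card (GL (Fin n) (ZMod p)) := by exact_mod_cast Nat.card_pos
  set s : ℝ := (Nat.card (GL (Fin n) (ZMod p)) : ℝ) / ((Nat.card G : ℝ)^n * (p:ℝ)^(n*n)) with hs
  have hspos : 0 ≤ s := by positivity
  set Eu := ∏' i : ℕ, (1 - (p : ℝ)⁻¹^(i+1)) with hEu
  have hb : ∀ φ, |(μ (E φ)).toReal - s * Eu| ≤ s * errT p (Nat.card G) n := by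
    intro φ
    have h1 := pair_bound (F := ZMod p) n (by rw [ZMod.card]; exact hp) (C φ) (Nat.card G) (hC1 φ)
    rw [ZMod.card] at h1
    have h2 : (μ (E φ)).toReal = s * ((Nat.card {U : GL (Fin n) (ZMod p) // (U.1 + C φ).det ≠ 0} : ℝ) / Nat.card (GL (Fin n) (ZMod p))) := by
      rw [hC3 φ, hs]
      field_simp
    rw [h2, ← mul_sub, abs_mul, abs_of_nonneg hspos]
    exact mul_le_mul_of_nonneg_left h1 hspos
  have e1 : ((Nat.card {φ : (Fin n → ℤ_[p]) →ₗ[ℤ_[p]] G // Function.Surjective φ} : ℝ) / (Nat.card G : ℝ)^n) *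
       (((Nat.card (GL (Fin n) (ZMod p)) : ℝ) / (p:ℝ)^(n*n)) * Eu) = ∑ φ : {φ : (Fin n → ℤ_[p]) →ₗ[ℤ_[p]] G // Function.Surjective φ}, s * Eu := by
    rw [Finset.sum_const, nsmul_eq_mul, Finset.card_univ, Nat.card_eq_fintype_card, hs]
    field_simp
  have e2 : ((Nat.card {φ : (Fin n → ℤ_[p]) →ₗ[ℤ_[p]] G // Function.Surjective φ} : ℝ) / (Nat.card G : ℝ)^n) *
       (((Nat.card (GL (Fin n) (ZMod p)) : ℝ) / (p:ℝ)^(n*n)) * errT p (Nat.card G) n) = ∑ φ : {φ : (Fin n → ℤ_[p]) →ₗ[ℤ_[p]] G // Function.Surjective φ}, s * errT p (Nat.card G) n := by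
    rw [Finset.sum_const, nsmul_eq_mul, Finset.card_univ, Nat.card_eq_fintype_card, hs]
    field_simp
  rw [e1, e2, ← Finset.sum_sub_distrib]
  exact (Finset.abs_sum_le_sum_abs _ _).trans (Finset.sum_le_sum fun φ _ => hb φ)
end assembly

/-- Friedman–Washington: for a Haar-random `X ∈ Mat_n(ℤ_p)`, the probability that
`cok(X) = 0` and `cok(X - Iₙ) ≃ G` tends, as `n → ∞`, to the product of the two
Cohen–Lenstra probabilities; i.e. the two events become independent. -/
theorem stmt_17 (p : ℕ) [Fact p.Prime] (G : Type) [AddCommGroup G] [Finite G]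
    (hG : ∃ k : ℕ, ∀ x : G, (p ^ k : ℕ) • x = 0)
    (μ : ∀ n : ℕ, Measure (Fin n → Fin n → ℤ_[p]))
    (hμ1 : ∀ n, IsProbabilityMeasure (μ n))
    (hμ2 : ∀ n, (μ n).IsAddHaarMeasure) :
    Filter.Tendsto (fun n =>
      ((μ n) {X | LinearMap.range (Matrix.of X).mulVecLin = ⊤ ∧
        Nonempty (((Fin n → ℤ_[p]) ⧸
          LinearMap.range (Matrix.of X - 1).mulVecLin) ≃+ G)}).toReal)
      Filter.atTop
      (nhds ((∏' i : ℕ, (1 - (p : ℝ)⁻¹ ^ (i + 1))) *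
        ((1 / (Nat.card (G ≃+ G) : ℝ)) * ∏' i : ℕ, (1 - (p : ℝ)⁻¹ ^ (i + 1))))) := by
  obtain ⟨inst, hlin⟩ := exists_module (p := p) G hG
  have hp : (2:ℝ) ≤ p := by exact_mod_cast (Fact.out : p.Prime).two_le
  have hA : (Nat.card (G ≃+ G) : ℝ) ≠ 0 := by exact_mod_cast Nat.card_pos.ne'
  have h1 := surj_tendsto (p := p) (G := G)
  have h2 := GL_frac_tendsto p
  have h3 := errT_tendsto p hp (Nat.card G)
  have herr := h1.mul (h2.mul h3)
  have hmain := h1.mul (h2.mul_const (∏' i : ℕ, (1 - (p : ℝ)⁻¹ ^ (i + 1))))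
  rw [mul_zero, mul_zero] at herr
  have hd : Filter.Tendsto (fun n => (Nat.card (G ≃+ G) : ℝ) * ((μ n) {X | LinearMap.range (Matrix.of X).mulVecLin = ⊤ ∧
        Nonempty (((Fin n → ℤ_[p]) ⧸ LinearMap.range (Matrix.of X - 1).mulVecLin) ≃+ G)}).toReal -
      ((Nat.card {φ : (Fin n → ℤ_[p]) →ₗ[ℤ_[p]] G // Function.Surjective φ} : ℝ) / (Nat.card G : ℝ)^n) *
       (((Nat.card (GL (Fin n) (ZMod p)) : ℝ) / (p:ℝ)^(n*n)) * (∏' i : ℕ, (1 - (p : ℝ)⁻¹^(i+1))))) Filter.atTop (nhds 0) := by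
    refine squeeze_zero_norm (fun n => ?_) herr
    have := hμ1 n
    have := hμ2 n
    rw [Real.norm_eq_abs]
    exact prob_eq (p := p) (G := G) hlin (μ n)
  have hs := (hd.add hmain).const_mul (Nat.card (G ≃+ G) : ℝ)⁻¹
  refine (hs.congr fun n => ?_).trans (le_of_eq ?_)
  · rw [sub_add_cancel, inv_mul_cancel_left₀ hA]
  · congr 1
    rw [zero_add, one_mul, one_div]; ring
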